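/- Fix μ, μ' ∈ P(X), ν ∈ P(Y), all with finite p-th moments and Y bounded, and a Markov kernel κ from X to Y such that, for some τ ≥ 0, ∫∫ ‖y − x‖^p dκ_x(y) dμ(x) ≤ W_p(μ, κ♯μ)^p + τ^p and W_p(κ♯μ, ν) ≤ τ. Then, setting ε = ‖μ − μ'‖_TV, one has E_p(κ;μ',ν) ≤ 3 diam(Y) ε^{1/p} + 3τ. -/

import Mathlib

open MeasureTheory ProbabilityTheory Set

noncomputable section

abbrev Rd (d : ℕ) : Type := EuclideanSpace ℝ (Fin d)

/-- `π` is a coupling of `μ` and `ν`. -/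
def IsCoupling {d : ℕ} (π : Measure (Rd d × Rd d)) (μ ν : Measure (Rd d)) : Prop :=
  π.map Prod.fst = μ ∧ π.map Prod.snd = ν

/-- The `p`-Wasserstein distance between `μ` and `ν`. -/
noncomputable def Wp {d : ℕ} (p : ℝ) (μ ν : Measure (Rd d)) : ℝ :=
  sInf { c : ℝ | ∃ π : Measure (Rd d × Rd d), IsCoupling π μ ν ∧
    c = (∫ z, ‖z.1 - z.2‖ ^ p ∂π) ^ (1 / p) }

/-- The transport cost `(∫∫ ‖x-y‖^p dκ_x(y) dμ(x))^{1/p}` of a kernel. -/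
noncomputable def kernelCost {d : ℕ} (p : ℝ) (κ : Kernel (Rd d) (Rd d))
    (μ : Measure (Rd d)) : ℝ :=
  (∫ x, ∫ y, ‖x - y‖ ^ p ∂(κ x) ∂μ) ^ (1 / p)

/-- Pushforward of `μ` by the kernel `κ`. -/
noncomputable def kpush {d : ℕ} (κ : Kernel (Rd d) (Rd d)) (μ : Measure (Rd d)) :
    Measure (Rd d) :=
  μ.bind fun x => κ x

/-- The transportation error `E_p(κ; μ, ν)`: optimality gap plus feasibility gap. -/
noncomputable def Ep {d : ℕ} (p : ℝ) (κ : Kernel (Rd d) (Rd d)) (μ ν : Measure (Rd d)) : ℝ :=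
  max (kernelCost p κ μ - Wp p μ ν) 0 + Wp p (kpush κ μ) ν

/-- Total variation distance between measures. -/
noncomputable def tvDist {α : Type*} [MeasurableSpace α] (μ ν : Measure α) : ℝ :=
  sSup { r : ℝ | ∃ A : Set α, MeasurableSet A ∧ r = |(μ A).toReal - (ν A).toReal| }

/-- Finite `p`-th moment. -/
def HasFiniteMoment {d : ℕ} (p : ℝ) (μ : Measure (Rd d)) : Prop :=
  Integrable (fun x => ‖x‖ ^ p) μ

/-- The extended `L^p` norm of the displacement `x - y` under a measure on pairs `(x, y)`. -/
def displacementNorm {d : ℕ} (p : ℝ) (π : Measure (Rd d × Rd d)) : ENNReal :=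
  eLpNorm' (fun z => z.1 - z.2) p π

lemma displacementNorm_add_rpow {d : ℕ} {p : ℝ} (hp : 0 < p) (π₁ π₂ : Measure (Rd d × Rd d)) :
    displacementNorm p (π₁ + π₂) ^ p = displacementNorm p π₁ ^ p + displacementNorm p π₂ ^ p := by
  simp only [displacementNorm, ← lintegral_rpow_enorm_eq_rpow_eLpNorm' hp,
    lintegral_add_measure]

lemma displacementNorm_mono {d : ℕ} {p : ℝ} (hp : 0 ≤ p) {π₁ π₂ : Measure (Rd d × Rd d)}
    (h : π₁ ≤ π₂) : displacementNorm p π₁ ≤ displacementNorm p π₂ :=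
  eLpNorm'_mono_measure _ h hp

lemma displacementNorm_map {α : Type*} [MeasurableSpace α] {d : ℕ} (p : ℝ) (M : Measure α)
    {f : α → Rd d × Rd d} (hf : Measurable f) :
    displacementNorm p (M.map f) = eLpNorm' (fun w => (f w).1 - (f w).2) p M := by
  simp only [displacementNorm, eLpNorm']
  rw [lintegral_map (by fun_prop) hf]

lemma displacementNorm_map_swap {d : ℕ} (p : ℝ) (π : Measure (Rd d × Rd d)) :
    displacementNorm p (π.map Prod.swap) = displacementNorm p π := by
  rw [displacementNorm_map p π measurable_swap]
  simp only [displacementNorm, eLpNorm', Prod.fst_swap, Prod.snd_swap]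
  simp_rw [enorm_sub_rev]

lemma displacementNorm_le_of_ae_mem {d : ℕ} {p : ℝ} (hp : 0 < p) {Y : Set (Rd d)}
    (hY : Bornology.IsBounded Y) {π : Measure (Rd d × Rd d)}
    (h₁ : ∀ᵐ z ∂π, z.1 ∈ Y) (h₂ : ∀ᵐ z ∂π, z.2 ∈ Y) :
    displacementNorm p π ≤ ENNReal.ofReal (Metric.diam Y) * π univ ^ (1 / p) := by
  have hle : displacementNorm p π ≤ eLpNorm' (fun _ => Metric.diam Y) p π := by
    refine eLpNorm'_mono_ae hp.le ?_
    filter_upwards [h₁, h₂] with z hz₁ hz₂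
    rw [Real.norm_of_nonneg Metric.diam_nonneg, ← dist_eq_norm]
    exact Metric.dist_le_diam_of_mem hY hz₁ hz₂
  rwa [eLpNorm'_const _ hp, Real.enorm_of_nonneg Metric.diam_nonneg] at hle

/-- The triangle inequality for displacement norms on triples. -/
lemma displacementNorm_triangle {α : Type*} [MeasurableSpace α] {d : ℕ} {p : ℝ} (hp : 1 ≤ p)
    (M : Measure α) {f g h : α → Rd d} (hf : Measurable f) (hg : Measurable g)
    (hh : Measurable h) :
    displacementNorm p (M.map fun w => (f w, h w)) ≤
      displacementNorm p (M.map fun w => (f w, g w)) +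
        displacementNorm p (M.map fun w => (g w, h w)) := by
  rw [displacementNorm_map p M (by fun_prop), displacementNorm_map p M (by fun_prop),
    displacementNorm_map p M (by fun_prop)]
  refine le_trans (le_of_eq ?_) (eLpNorm'_add_le (by fun_prop) (by fun_prop) hp)
  congr 1
  ext1 w
  simp

/-- Gluing of two measures on a product along a common marginal. -/
lemma exists_gluing {d : ℕ} (π₁ π₂ : Measure (Rd d × Rd d)) [IsFiniteMeasure π₁]
    [IsFiniteMeasure π₂] (h : π₁.map Prod.snd = π₂.map Prod.fst) :
    ∃ M : Measure ((Rd d × Rd d) × Rd d),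
      M.map Prod.fst = π₁ ∧ M.map (fun w => (w.1.2, w.2)) = π₂ := by
  refine ⟨π₁ ⊗ₘ Kernel.prodMkLeft (Rd d) π₂.condKernel, Measure.fst_compProd _ _, ?_⟩
  ext s hs
  rw [Measure.map_apply (by fun_prop) hs,
    Measure.compProd_apply ((by fun_prop : Measurable fun w : (Rd d × Rd d) × Rd d =>
      (w.1.2, w.2)) hs)]
  conv_rhs => rw [← π₂.disintegrate π₂.condKernel]
  rw [Measure.compProd_apply hs, Measure.fst, ← h,
    lintegral_map (Kernel.measurable_kernel_prodMk_left hs) measurable_snd]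
  rfl

lemma IsCoupling.isFiniteMeasure {d : ℕ} {π : Measure (Rd d × Rd d)} {σ ρ : Measure (Rd d)}
    [IsFiniteMeasure σ] (h : IsCoupling π σ ρ) : IsFiniteMeasure π := by
  refine ⟨?_⟩
  have := measure_lt_top σ univ
  rwa [← h.1, Measure.map_apply measurable_fst .univ] at this

lemma IsCoupling.univ_eq {d : ℕ} {π : Measure (Rd d × Rd d)} {σ ρ : Measure (Rd d)}
    (h : IsCoupling π σ ρ) : π univ = σ univ := by
  rw [← h.1, Measure.map_apply measurable_fst .univ, preimage_univ]

lemma IsCoupling.swap {d : ℕ} {π : Measure (Rd d × Rd d)} {σ ρ : Measure (Rd d)}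
    (h : IsCoupling π σ ρ) : IsCoupling (π.map Prod.swap) ρ σ := by
  constructor
  · rw [Measure.map_map measurable_fst measurable_swap, ← h.2]; rfl
  · rw [Measure.map_map measurable_snd measurable_swap, ← h.1]; rfl

lemma IsCoupling.add {d : ℕ} {π₁ π₂ : Measure (Rd d × Rd d)} {σ₁ σ₂ ρ₁ ρ₂ : Measure (Rd d)}
    (h₁ : IsCoupling π₁ σ₁ ρ₁) (h₂ : IsCoupling π₂ σ₂ ρ₂) :
    IsCoupling (π₁ + π₂) (σ₁ + σ₂) (ρ₁ + ρ₂) := by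
  constructor
  · rw [Measure.map_add _ _ measurable_fst, h₁.1, h₂.1]
  · rw [Measure.map_add _ _ measurable_snd, h₁.2, h₂.2]

lemma IsCoupling.exists_trans {d : ℕ} {p : ℝ} (hp : 1 ≤ p) {π₁ π₂ : Measure (Rd d × Rd d)}
    {σ ρ θ : Measure (Rd d)} [IsFiniteMeasure σ] [IsFiniteMeasure ρ]
    (h₁ : IsCoupling π₁ σ ρ) (h₂ : IsCoupling π₂ ρ θ) :
    ∃ π, IsCoupling π σ θ ∧
      displacementNorm p π ≤ displacementNorm p π₁ + displacementNorm p π₂ := by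
  have := h₁.isFiniteMeasure
  have := h₂.isFiniteMeasure
  obtain ⟨M, hM₁, hM₂⟩ := exists_gluing π₁ π₂ (h₁.2.trans h₂.1.symm)
  refine ⟨M.map fun w => (w.1.1, w.2), ⟨?_, ?_⟩, ?_⟩
  · rw [Measure.map_map measurable_fst (by fun_prop), ← h₁.1, ← hM₁,
      Measure.map_map measurable_fst measurable_fst]
    rfl
  · rw [Measure.map_map measurable_snd (by fun_prop), ← h₂.2, ← hM₂,
      Measure.map_map measurable_snd (by fun_prop)]
    rfl
  · refine (displacementNorm_triangle hp M (f := fun w => w.1.1) (g := fun w => w.1.2)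
      (h := fun w => w.2) (by fun_prop) (by fun_prop) (by fun_prop)).trans ?_
    rw [hM₂]
    exact (congrArg (fun m => displacementNorm p m + _) hM₁).le

/-- A coupling splits along a decomposition of its first marginal. -/
lemma IsCoupling.exists_split {d : ℕ} {π : Measure (Rd d × Rd d)}
    {σ₁ σ₂ ρ : Measure (Rd d)} [IsFiniteMeasure σ₁] [IsFiniteMeasure σ₂]
    (h : IsCoupling π (σ₁ + σ₂) ρ) :
    ∃ π₁ π₂ : Measure (Rd d × Rd d), ∃ ρ₁ ρ₂ : Measure (Rd d), π₁ + π₂ = π ∧ ρ₁ + ρ₂ = ρ ∧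
      IsCoupling π₁ σ₁ ρ₁ ∧ IsCoupling π₂ σ₂ ρ₂ := by
  have := h.isFiniteMeasure
  have hadd : σ₁ ⊗ₘ π.condKernel + σ₂ ⊗ₘ π.condKernel = π := by
    rw [← Measure.compProd_add_left, ← h.1]
    exact π.disintegrate π.condKernel
  refine ⟨σ₁ ⊗ₘ π.condKernel, σ₂ ⊗ₘ π.condKernel, _, _, hadd, ?_,
    ⟨Measure.fst_compProd _ _, rfl⟩, ⟨Measure.fst_compProd _ _, rfl⟩⟩
  rw [← Measure.map_add _ _ measurable_snd, hadd, h.2]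

/-- Two finite measures decompose into a common part and excess parts. -/
lemma exists_common_part {α : Type*} [MeasurableSpace α] (σ ρ : Measure α) [IsFiniteMeasure σ]
    [IsFiniteMeasure ρ] :
    ∃ s u v : Measure α, σ = s + u ∧ ρ = s + v ∧ ∃ S, MeasurableSet S ∧
      u univ + ρ S = σ S ∧ v univ + σ Sᶜ = ρ Sᶜ := by
  obtain ⟨S, hS, h₁, h₂⟩ := exists_isHahnDecomposition ρ σ
  refine ⟨ρ.restrict S + σ.restrict Sᶜ, σ.restrict S - ρ.restrict S,
    ρ.restrict Sᶜ - σ.restrict Sᶜ, ?_, ?_, S, hS, ?_, ?_⟩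
  · rw [add_assoc, add_comm, add_assoc, Measure.sub_add_cancel_of_le h₁, add_comm,
      Measure.restrict_add_restrict_compl hS]
  · rw [add_assoc, add_comm (σ.restrict Sᶜ), Measure.sub_add_cancel_of_le h₂,
      Measure.restrict_add_restrict_compl hS]
  · rw [Measure.sub_apply .univ h₁]
    simpa using tsub_add_cancel_of_le (by simpa using h₁ univ)
  · rw [Measure.sub_apply .univ h₂]
    simpa using tsub_add_cancel_of_le (by simpa using h₂ univ)

lemma isCoupling_diag {d : ℕ} (σ : Measure (Rd d)) :
    IsCoupling (σ.map fun x => (x, x)) σ σ := by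
  constructor
  · rw [Measure.map_map measurable_fst (by fun_prop)]; exact Measure.map_id
  · rw [Measure.map_map measurable_snd (by fun_prop)]; exact Measure.map_id

lemma displacementNorm_diag {d : ℕ} {p : ℝ} (hp : 0 < p) (σ : Measure (Rd d)) :
    displacementNorm p (σ.map fun x => (x, x)) = 0 := by
  rw [displacementNorm_map p σ (by fun_prop)]
  simp [eLpNorm', hp]

lemma exists_isCoupling_of_univ_eq {d : ℕ} (σ ρ : Measure (Rd d)) [IsFiniteMeasure σ]
    [IsFiniteMeasure ρ] (h : σ univ = ρ univ) : ∃ π, IsCoupling π σ ρ := by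
  rcases eq_or_ne (σ univ) 0 with h0 | h0
  · have hσ := Measure.measure_univ_eq_zero.1 h0
    have hρ := Measure.measure_univ_eq_zero.1 (h ▸ h0)
    exact ⟨0, by simp [hσ], by simp [hρ]⟩
  · refine ⟨(σ univ)⁻¹ • σ.prod ρ, ?_, ?_⟩
    · rw [Measure.map_smul, Measure.map_fst_prod, smul_smul, ← h,
        ENNReal.inv_mul_cancel h0 (measure_ne_top _ _), one_smul]
    · rw [Measure.map_smul, Measure.map_snd_prod, smul_smul,
        ENNReal.inv_mul_cancel h0 (measure_ne_top _ _), one_smul]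

/-- Measures on a bounded set of equal mass that are setwise close admit a cheap coupling. -/
lemma exists_isCoupling_of_le_add {d : ℕ} {p : ℝ} (hp : 1 ≤ p) {Y : Set (Rd d)}
    (hY : Bornology.IsBounded Y) (σ ρ : Measure (Rd d)) [IsFiniteMeasure σ] [IsFiniteMeasure ρ]
    (hσ : ∀ᵐ x ∂σ, x ∈ Y) (hρ : ∀ᵐ x ∂ρ, x ∈ Y) (hmass : σ univ = ρ univ) {ε : ENNReal}
    (hε : ∀ A, MeasurableSet A → σ A ≤ ρ A + ε) :
    ∃ π, IsCoupling π σ ρ ∧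
      displacementNorm p π ≤ ENNReal.ofReal (Metric.diam Y) * ε ^ (1 / p) := by
  have hp0 : 0 < p := by linarith
  obtain ⟨s, u, v, rfl, rfl, S, hS, hu, -⟩ := exists_common_part σ ρ
  have hs : IsFiniteMeasure s := isFiniteMeasure_of_le (s + u) (Measure.le_add_right le_rfl)
  have hufin : IsFiniteMeasure u := isFiniteMeasure_of_le (s + u) (Measure.le_add_left le_rfl)
  have hvfin : IsFiniteMeasure v := isFiniteMeasure_of_le (s + v) (Measure.le_add_left le_rfl)
  have huv : u univ = v univ := by
    simp only [Measure.add_apply] at hmass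
    exact (ENNReal.add_right_inj (measure_ne_top s univ)).1 hmass
  have huε : u univ ≤ ε := by
    have := hε S hS
    rw [← hu, add_comm] at this
    exact (ENNReal.add_le_add_iff_left (measure_ne_top (s + v) S)).1 this
  obtain ⟨π, hπ⟩ := exists_isCoupling_of_univ_eq u v huv
  refine ⟨_, (isCoupling_diag s).add hπ, ?_⟩
  have h₁ : ∀ᵐ z ∂π, z.1 ∈ Y := by
    refine ae_of_ae_map measurable_fst.aemeasurable (p := fun x => x ∈ Y) ?_
    rw [hπ.1]; exact (ae_add_measure_iff.1 hσ).2
  have h₂ : ∀ᵐ z ∂π, z.2 ∈ Y := by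
    refine ae_of_ae_map measurable_snd.aemeasurable (p := fun x => x ∈ Y) ?_
    rw [hπ.2]; exact (ae_add_measure_iff.1 hρ).2
  have hπY := displacementNorm_le_of_ae_mem hp0 hY h₁ h₂
  rw [hπ.univ_eq] at hπY
  rw [← ENNReal.rpow_le_rpow_iff hp0, displacementNorm_add_rpow hp0, displacementNorm_diag hp0,
    ENNReal.zero_rpow_of_pos hp0, zero_add]
  gcongr
  exact hπY.trans (by gcongr)

lemma kpush_eq_map_snd {d : ℕ} (κ : Kernel (Rd d) (Rd d)) [IsMarkovKernel κ]
    (μ : Measure (Rd d)) [IsFiniteMeasure μ] : (μ ⊗ₘ κ).map Prod.snd = kpush κ μ :=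
  Measure.snd_compProd μ κ

lemma isCoupling_compProd {d : ℕ} (κ : Kernel (Rd d) (Rd d)) [IsMarkovKernel κ]
    (μ : Measure (Rd d)) [IsFiniteMeasure μ] : IsCoupling (μ ⊗ₘ κ) μ (kpush κ μ) :=
  ⟨Measure.fst_compProd μ κ, kpush_eq_map_snd κ μ⟩

lemma kpush_add {d : ℕ} (κ : Kernel (Rd d) (Rd d)) [IsMarkovKernel κ]
    (μ₁ μ₂ : Measure (Rd d)) [IsFiniteMeasure μ₁] [IsFiniteMeasure μ₂] :
    kpush κ (μ₁ + μ₂) = kpush κ μ₁ + kpush κ μ₂ := by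
  rw [← kpush_eq_map_snd, Measure.compProd_add_left, Measure.map_add _ _ measurable_snd,
    kpush_eq_map_snd, kpush_eq_map_snd]

lemma IsCoupling.univ_eq_univ {d : ℕ} {π : Measure (Rd d × Rd d)} {σ ρ : Measure (Rd d)}
    (h : IsCoupling π σ ρ) : σ univ = ρ univ := by
  rw [← h.univ_eq, ← h.swap.univ_eq, Measure.map_apply measurable_swap .univ, preimage_univ]

lemma IsCoupling.isFiniteMeasure_right {d : ℕ} {π : Measure (Rd d × Rd d)} {σ ρ : Measure (Rd d)}
    [IsFiniteMeasure σ] (h : IsCoupling π σ ρ) : IsFiniteMeasure ρ :=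
  ⟨h.univ_eq_univ ▸ measure_lt_top σ univ⟩

/-- Couplings with a common first marginal and second marginals on a bounded set have
displacement norms differing by at most a multiple of the diameter. -/
lemma IsCoupling.displacementNorm_le_add {d : ℕ} {p : ℝ} (hp : 1 ≤ p) {Y : Set (Rd d)}
    (hY : Bornology.IsBounded Y) {π₁ π₂ : Measure (Rd d × Rd d)} {σ ρ₁ ρ₂ : Measure (Rd d)}
    [IsFiniteMeasure σ] (h₁ : IsCoupling π₁ σ ρ₁) (h₂ : IsCoupling π₂ σ ρ₂)
    (hρ₁ : ∀ᵐ y ∂ρ₁, y ∈ Y) (hρ₂ : ∀ᵐ y ∂ρ₂, y ∈ Y) :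
    displacementNorm p π₂ ≤
      displacementNorm p π₁ + ENNReal.ofReal (Metric.diam Y) * σ univ ^ (1 / p) := by
  have := h₁.isFiniteMeasure
  have := h₂.isFiniteMeasure
  obtain ⟨M, hM₁, hM₂⟩ := exists_gluing (π₁.map Prod.swap) π₂ (h₁.swap.2.trans h₂.1.symm)
  have hM₁' : M.map (fun w => (w.1.2, w.1.1)) = π₁ := by
    have := congrArg (Measure.map Prod.swap) hM₁
    rw [Measure.map_map measurable_swap measurable_fst,
      Measure.map_map measurable_swap measurable_swap] at this
    rw [Prod.swap_swap_eq, Measure.map_id] at this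
    exact this
  have htri := displacementNorm_triangle hp M (f := fun w => w.1.2) (g := fun w => w.1.1)
      (h := fun w => w.2) (by fun_prop) (by fun_prop) (by fun_prop)
  rw [hM₁', hM₂] at htri
  refine htri.trans ?_
  gcongr
  have hmass : M.map (fun w => (w.1.1, w.2)) univ = σ univ := by
    rw [← h₁.univ_eq, ← hM₁', Measure.map_apply (by fun_prop) .univ,
      Measure.map_apply (by fun_prop) .univ, preimage_univ, preimage_univ]
  rw [← hmass]
  refine displacementNorm_le_of_ae_mem (by linarith) hY ?_ ?_
  · refine ae_of_ae_map measurable_fst.aemeasurable (p := fun x => x ∈ Y) ?_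
    rw [← h₁.2, ← hM₁', Measure.map_map measurable_snd (by fun_prop)] at hρ₁
    rw [Measure.map_map measurable_fst (by fun_prop)]
    exact hρ₁
  · refine ae_of_ae_map measurable_snd.aemeasurable (p := fun x => x ∈ Y) ?_
    rw [← h₂.2, ← hM₂, Measure.map_map measurable_snd (by fun_prop)] at hρ₂
    rw [Measure.map_map measurable_snd (by fun_prop)]
    exact hρ₂

/-- Minkowski's inequality for pairs of extended nonnegative reals. -/
lemma rpow_add_rpow_add_le {p : ℝ} (hp : 1 ≤ p) (a b c e : ENNReal) :
    ((a + c) ^ p + (b + e) ^ p) ^ (1 / p) ≤ (a ^ p + b ^ p) ^ (1 / p) + (c + e) := by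
  have h := ENNReal.Lp_add_le Finset.univ ![a, b] ![c, e] hp
  simp only [Fin.sum_univ_two, Matrix.cons_val_zero, Matrix.cons_val_one] at h
  exact h.trans (by gcongr; exact ENNReal.rpow_add_rpow_le_add c e hp)

/-- The transport cost of a near-optimal kernel under a perturbed source measure. -/
lemma displacementNorm_compProd_le {d : ℕ} {p : ℝ} (hp : 1 ≤ p) {Y : Set (Rd d)}
    (hY : Bornology.IsBounded Y) (κ : Kernel (Rd d) (Rd d)) [IsMarkovKernel κ]
    (s a b ν : Measure (Rd d)) [IsFiniteMeasure s] [IsFiniteMeasure a] [IsFiniteMeasure b]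
    {ε t : ENNReal} (ha : a univ ≤ ε) (hb : b univ ≤ ε)
    (hνY : ∀ᵐ y ∂ν, y ∈ Y) (hsY : ∀ᵐ y ∂(kpush κ (s + a)), y ∈ Y)
    (hbY : ∀ᵐ y ∂(kpush κ b), y ∈ Y)
    (hfin : displacementNorm p ((s + a) ⊗ₘ κ) ≠ ⊤)
    (hopt : ∀ q, IsCoupling q (s + a) (kpush κ (s + a)) →
      displacementNorm p ((s + a) ⊗ₘ κ) ^ p ≤ displacementNorm p q ^ p + t ^ p)
    {π γ : Measure (Rd d × Rd d)} (hπ : IsCoupling π (s + b) ν)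
    (hγ : IsCoupling γ (kpush κ (s + a)) ν) :
    displacementNorm p ((s + b) ⊗ₘ κ) ≤ displacementNorm p π +
      (displacementNorm p γ + t + 2 * (ENNReal.ofReal (Metric.diam Y) * ε ^ (1 / p))) := by
  have hp0 : 0 < p := by linarith
  set e := ENNReal.ofReal (Metric.diam Y) * ε ^ (1 / p) with he
  obtain ⟨πs, πb, ν₁, ν₂, hπadd, rfl, hπs, hπb⟩ := hπ.exists_split
  have hν₁ := hπs.isFiniteMeasure_right
  have hν₂ := hπb.isFiniteMeasure_right
  obtain ⟨γ₁, γ₂, σ₁, σ₂, hγadd, hσadd, hγ₁, hγ₂⟩ := hγ.swap.exists_split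
  have hσ₁ := hγ₁.isFiniteMeasure_right
  have hσ₂ := hγ₂.isFiniteMeasure_right
  have hks := (isCoupling_compProd κ s).isFiniteMeasure_right
  have hka := (isCoupling_compProd κ a).isFiniteMeasure_right
  rw [kpush_add] at hσadd
  have hclose : ∀ A, MeasurableSet A → σ₁ A ≤ kpush κ s A + ε := by
    intro A _
    calc σ₁ A ≤ (σ₁ + σ₂) A := by simp
      _ = kpush κ s A + kpush κ a A := by rw [hσadd, Measure.add_apply]
      _ ≤ kpush κ s A + ε := by
        gcongr
        refine (measure_mono (subset_univ A)).trans ?_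
        rwa [← (isCoupling_compProd κ a).univ_eq_univ]
  have hY' : ∀ᵐ y ∂(σ₁ + σ₂), y ∈ Y := by rwa [hσadd, ← kpush_add]
  rw [kpush_add] at hsY
  obtain ⟨q₁, hq₁, hq₁le⟩ := exists_isCoupling_of_le_add hp hY σ₁ (kpush κ s)
    (ae_add_measure_iff.1 hY').1 (ae_add_measure_iff.1 hsY).1
    (by rw [← hγ₁.univ_eq_univ, ← hπs.univ_eq_univ, (isCoupling_compProd κ s).univ_eq_univ])
    hclose
  obtain ⟨q₂, hq₂, hq₂le⟩ := hγ₁.exists_trans hp hq₁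
  obtain ⟨q, hq, hqle⟩ := hπs.exists_trans hp hq₂
  have hγ₁le : displacementNorm p γ₁ ≤ displacementNorm p γ := by
    rw [← displacementNorm_map_swap p γ, ← hγadd]
    exact displacementNorm_mono hp0.le (Measure.le_add_right le_rfl)
  have hqle' : displacementNorm p q ≤ displacementNorm p πs + (displacementNorm p γ + e) :=
    hqle.trans (by gcongr; exact hq₂le.trans (by gcongr))
  have hs : displacementNorm p (s ⊗ₘ κ) ^ p ≤ displacementNorm p q ^ p + t ^ p := by
    have h := hopt (q + a ⊗ₘ κ) (by rw [kpush_add]; exact hq.add (isCoupling_compProd κ a))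
    have hfin' : displacementNorm p (a ⊗ₘ κ) ^ p ≠ ⊤ := by
      refine ENNReal.rpow_ne_top_of_nonneg hp0.le (ne_top_of_le_ne_top hfin ?_)
      rw [Measure.compProd_add_left]
      exact displacementNorm_mono hp0.le (Measure.le_add_left le_rfl)
    rw [Measure.compProd_add_left, displacementNorm_add_rpow hp0, displacementNorm_add_rpow hp0,
      add_right_comm] at h
    exact (ENNReal.add_le_add_iff_right hfin').1 h
  have hbκ : displacementNorm p (b ⊗ₘ κ) ≤ displacementNorm p πb + e := by
    refine (hπb.displacementNorm_le_add hp hY (isCoupling_compProd κ b)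
      (ae_add_measure_iff.1 hνY).2 hbY).trans ?_
    rw [he]
    gcongr
  have hroot : ∀ x : ENNReal, (x ^ p) ^ (1 / p) = x := fun x => by
    rw [one_div, ENNReal.rpow_rpow_inv hp0.ne']
  calc displacementNorm p ((s + b) ⊗ₘ κ)
      = (displacementNorm p (s ⊗ₘ κ) ^ p + displacementNorm p (b ⊗ₘ κ) ^ p) ^ (1 / p) := by
        rw [← displacementNorm_add_rpow hp0, ← Measure.compProd_add_left, hroot]
    _ ≤ ((((displacementNorm p πs + (displacementNorm p γ + e)) ^ p
          + (displacementNorm p πb + e) ^ p) ^ (1 / p)) ^ p + t ^ p) ^ (1 / p) := by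
        gcongr ?_ ^ (1 / p)
        rw [one_div, ENNReal.rpow_inv_rpow hp0.ne', add_right_comm]
        gcongr
        exact hs.trans (by gcongr)
    _ ≤ ((displacementNorm p πs + (displacementNorm p γ + e)) ^ p
          + (displacementNorm p πb + e) ^ p) ^ (1 / p) + t :=
        ENNReal.rpow_add_rpow_le_add _ _ hp
    _ ≤ ((displacementNorm p πs ^ p + displacementNorm p πb ^ p) ^ (1 / p)
          + (displacementNorm p γ + e + e)) + t := by
        gcongr
        exact rpow_add_rpow_add_le hp _ _ _ _
    _ = displacementNorm p π + (displacementNorm p γ + t + 2 * e) := by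
        rw [← displacementNorm_add_rpow hp0, hπadd, hroot]
        ring

lemma abs_sub_le_tvDist {α : Type*} [MeasurableSpace α] (μ ν : Measure α)
    [IsProbabilityMeasure μ] [IsProbabilityMeasure ν] {A : Set α} (hA : MeasurableSet A) :
    |(μ A).toReal - (ν A).toReal| ≤ tvDist μ ν := by
  refine le_csSup ⟨1, ?_⟩ ⟨A, hA, rfl⟩
  rintro r ⟨B, -, rfl⟩
  have h₁ : (μ B).toReal ≤ 1 := measureReal_le_one
  have h₂ : (ν B).toReal ≤ 1 := measureReal_le_one
  have h₃ : 0 ≤ (μ B).toReal := ENNReal.toReal_nonneg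
  have h₄ : 0 ≤ (ν B).toReal := ENNReal.toReal_nonneg
  rw [abs_le]
  constructor <;> linarith

lemma le_ofReal_tvDist {α : Type*} [MeasurableSpace α] (μ ν : Measure α)
    [IsProbabilityMeasure μ] [IsProbabilityMeasure ν] {A : Set α} (hA : MeasurableSet A)
    {m : ENNReal} (hm : m + ν A = μ A) : m ≤ ENNReal.ofReal (tvDist μ ν) := by
  have hmfin : m ≠ ⊤ := ne_top_of_le_ne_top (measure_ne_top μ A) (hm ▸ le_self_add)
  refine ENNReal.le_ofReal_iff_toReal_le hmfin ?_ |>.2 ?_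
  · exact (abs_nonneg _).trans (abs_sub_le_tvDist μ ν hA)
  · have h := congrArg ENNReal.toReal hm
    rw [ENNReal.toReal_add hmfin (measure_ne_top ν A)] at h
    have := (le_abs_self _).trans (abs_sub_le_tvDist μ ν hA)
    linarith

lemma tvDist_comm {α : Type*} [MeasurableSpace α] (μ ν : Measure α) :
    tvDist μ ν = tvDist ν μ := by
  simp only [tvDist, abs_sub_comm]

lemma hasFiniteMoment_iff_memLp {d : ℕ} {p : ℝ} (hp : 1 ≤ p) (μ : Measure (Rd d)) :
    HasFiniteMoment p μ ↔ MemLp id (ENNReal.ofReal p) μ := by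
  rw [← integrable_norm_rpow_iff (by fun_prop) (by simp; linarith) (by simp),
    ENNReal.toReal_ofReal (by linarith)]
  rfl

lemma displacementNorm_eq_eLpNorm {d : ℕ} {p : ℝ} (hp : 1 ≤ p) (π : Measure (Rd d × Rd d)) :
    displacementNorm p π = eLpNorm (fun z => z.1 - z.2) (ENNReal.ofReal p) π := by
  rw [eLpNorm_eq_eLpNorm' (by simp; linarith) (by simp), ENNReal.toReal_ofReal (by linarith)]
  rfl

lemma memLp_of_displacementNorm_ne_top {d : ℕ} {p : ℝ} (hp : 1 ≤ p)
    {π : Measure (Rd d × Rd d)} (h : displacementNorm p π ≠ ⊤) :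
    MemLp (fun z : Rd d × Rd d => z.1 - z.2) (ENNReal.ofReal p) π :=
  ⟨by fun_prop, by rw [← displacementNorm_eq_eLpNorm hp]; exact h.lt_top⟩

lemma integral_cost_rpow_nonneg {d : ℕ} (p : ℝ) (π : Measure (Rd d × Rd d)) :
    0 ≤ (∫ z, ‖z.1 - z.2‖ ^ p ∂π) ^ (1 / p) :=
  Real.rpow_nonneg (integral_nonneg fun _ => Real.rpow_nonneg (norm_nonneg _) _) _

lemma toReal_displacementNorm {d : ℕ} {p : ℝ} (hp : 1 ≤ p)
    {π : Measure (Rd d × Rd d)} (h : displacementNorm p π ≠ ⊤) :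
    (displacementNorm p π).toReal = (∫ z, ‖z.1 - z.2‖ ^ p ∂π) ^ (1 / p) := by
  rw [displacementNorm_eq_eLpNorm hp, (memLp_of_displacementNorm_ne_top hp
    h).eLpNorm_eq_integral_rpow_norm (by simp; linarith) (by simp),
    ENNReal.toReal_ofReal (by simpa only [one_div] using integral_cost_rpow_nonneg _ π), one_div,
    ENNReal.toReal_ofReal (by linarith)]

lemma IsCoupling.displacementNorm_ne_top {d : ℕ} {p : ℝ} (hp : 1 ≤ p)
    {π : Measure (Rd d × Rd d)} {σ ρ : Measure (Rd d)} (h : IsCoupling π σ ρ)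
    (hσ : HasFiniteMoment p σ) (hρ : HasFiniteMoment p ρ) : displacementNorm p π ≠ ⊤ := by
  rw [hasFiniteMoment_iff_memLp hp] at hσ hρ
  rw [← h.1] at hσ
  rw [← h.2] at hρ
  rw [displacementNorm_eq_eLpNorm hp]
  exact ((hσ.comp_of_map measurable_fst.aemeasurable).sub
    (hρ.comp_of_map measurable_snd.aemeasurable)).eLpNorm_ne_top

lemma Wp_nonneg {d : ℕ} (p : ℝ) (σ ρ : Measure (Rd d)) : 0 ≤ Wp p σ ρ :=
  Real.sInf_nonneg <| by
    rintro c ⟨π, -, rfl⟩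
    exact integral_cost_rpow_nonneg p π

lemma IsCoupling.Wp_le {d : ℕ} {p : ℝ} (hp : 1 ≤ p) {π : Measure (Rd d × Rd d)}
    {σ ρ : Measure (Rd d)} (h : IsCoupling π σ ρ) (hfin : displacementNorm p π ≠ ⊤) :
    Wp p σ ρ ≤ (displacementNorm p π).toReal := by
  refine csInf_le ⟨0, ?_⟩ ⟨π, h, toReal_displacementNorm hp hfin⟩
  rintro c ⟨π, -, rfl⟩
  exact integral_cost_rpow_nonneg p π

lemma exists_isCoupling_lt_Wp_add {d : ℕ} {p : ℝ} (hp : 1 ≤ p) (σ ρ : Measure (Rd d))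
    [IsProbabilityMeasure σ] [IsProbabilityMeasure ρ] (hσ : HasFiniteMoment p σ)
    (hρ : HasFiniteMoment p ρ) {δ : ℝ} (hδ : 0 < δ) :
    ∃ π, IsCoupling π σ ρ ∧ displacementNorm p π ≠ ⊤ ∧
      (displacementNorm p π).toReal ≤ Wp p σ ρ + δ := by
  obtain ⟨π₀, hπ₀⟩ := exists_isCoupling_of_univ_eq σ ρ (by simp)
  obtain ⟨c, ⟨π, hπ, rfl⟩, hc⟩ := exists_lt_of_csInf_lt
    (s := { c : ℝ | ∃ π : Measure (Rd d × Rd d), IsCoupling π σ ρ ∧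
      c = (∫ z, ‖z.1 - z.2‖ ^ p ∂π) ^ (1 / p) }) ⟨_, π₀, hπ₀, rfl⟩ (lt_add_of_pos_right _ hδ)
  have hfin := hπ.displacementNorm_ne_top hp hσ hρ
  exact ⟨π, hπ, hfin, (toReal_displacementNorm hp hfin).trans_le hc.le⟩

lemma integral_compProd_cost {d : ℕ} {p : ℝ} (hp : 1 ≤ p) (κ : Kernel (Rd d) (Rd d))
    [IsMarkovKernel κ] (μ : Measure (Rd d)) [IsFiniteMeasure μ]
    (hfin : displacementNorm p (μ ⊗ₘ κ) ≠ ⊤) :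
    ∫ z, ‖z.1 - z.2‖ ^ p ∂(μ ⊗ₘ κ) = ∫ x, ∫ y, ‖x - y‖ ^ p ∂(κ x) ∂μ := by
  have h := (memLp_of_displacementNorm_ne_top hp hfin).integrable_norm_rpow
    (by simp; linarith) (by simp)
  rw [ENNReal.toReal_ofReal (by linarith)] at h
  exact Measure.integral_compProd h

lemma toReal_displacementNorm_compProd {d : ℕ} {p : ℝ} (hp : 1 ≤ p)
    (κ : Kernel (Rd d) (Rd d)) [IsMarkovKernel κ] (μ : Measure (Rd d)) [IsFiniteMeasure μ]
    (hfin : displacementNorm p (μ ⊗ₘ κ) ≠ ⊤) :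
    (displacementNorm p (μ ⊗ₘ κ)).toReal = kernelCost p κ μ := by
  rw [toReal_displacementNorm hp hfin, integral_compProd_cost hp κ μ hfin, kernelCost]

lemma hasFiniteMoment_of_ae_mem {d : ℕ} {p : ℝ} (hp : 1 ≤ p) {Y : Set (Rd d)}
    (hY : Bornology.IsBounded Y) (ρ : Measure (Rd d)) [IsFiniteMeasure ρ]
    (hρ : ∀ᵐ y ∂ρ, y ∈ Y) : HasFiniteMoment p ρ := by
  rw [hasFiniteMoment_iff_memLp hp]
  obtain ⟨C, hC⟩ := hY.exists_norm_le
  exact MemLp.of_bound (by fun_prop) C (hρ.mono fun y hy => hC y hy)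

lemma ae_mem_kpush {d : ℕ} {X Y : Set (Rd d)} (hX : MeasurableSet X) (hY : MeasurableSet Y)
    (κ : Kernel (Rd d) (Rd d)) [IsMarkovKernel κ] (μ : Measure (Rd d)) [IsProbabilityMeasure μ]
    (hμX : μ X = 1) (hκY : ∀ x ∈ X, κ x Y = 1) : ∀ᵐ y ∂(kpush κ μ), y ∈ Y := by
  refine Measure.ae_comp_of_ae_ae hY ?_
  filter_upwards [(mem_ae_iff_prob_eq_one hX).2 hμX] with x hx
  exact (mem_ae_iff_prob_eq_one hY).2 (hκY x hx)

/-- Near-optimality of a kernel, compared with an arbitrary coupling of the same marginals. -/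
lemma near_optimal_displacementNorm {d : ℕ} {p : ℝ} (hp : 1 ≤ p) (κ : Kernel (Rd d) (Rd d))
    [IsMarkovKernel κ] (μ : Measure (Rd d)) [IsFiniteMeasure μ]
    (hfin : displacementNorm p (μ ⊗ₘ κ) ≠ ⊤) {τ : ℝ} (hτ : 0 ≤ τ)
    (hnearopt : (∫ x, ∫ y, ‖y - x‖ ^ p ∂(κ x) ∂μ) ≤ Wp p μ (kpush κ μ) ^ p + τ ^ p)
    (q : Measure (Rd d × Rd d)) (hq : IsCoupling q μ (kpush κ μ)) :
    displacementNorm p (μ ⊗ₘ κ) ^ p ≤ displacementNorm p q ^ p + ENNReal.ofReal τ ^ p := by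
  have hp0 : 0 < p := by linarith
  rcases eq_or_ne (displacementNorm p q) ⊤ with htop | hqfin
  · simp [htop, ENNReal.top_rpow_of_pos hp0]
  have hpow : ∀ {x : ENNReal}, x ≠ ⊤ → x ^ p ≠ ⊤ := fun hx =>
    ENNReal.rpow_ne_top_of_nonneg hp0.le hx
  have hτfin := hpow (ENNReal.ofReal_ne_top (r := τ))
  rw [← ENNReal.toReal_le_toReal (hpow hfin) (ENNReal.add_ne_top.2 ⟨hpow hqfin, hτfin⟩),
    ENNReal.toReal_add (hpow hqfin) hτfin, ← ENNReal.toReal_rpow, ← ENNReal.toReal_rpow,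
    ← ENNReal.toReal_rpow, ENNReal.toReal_ofReal hτ, toReal_displacementNorm hp hfin, one_div,
    Real.rpow_inv_rpow (integral_nonneg fun _ => Real.rpow_nonneg (norm_nonneg _) _) hp0.ne',
    integral_compProd_cost hp κ μ hfin]
  refine le_trans (by simpa only [norm_sub_rev] using hnearopt) ?_
  gcongr
  · exact Wp_nonneg p _ _
  · exact hq.Wp_le hp hqfin

/-- Refined TV stability: if `κ` is `τ`-near-optimal for transporting `μ`
onto `κ♯μ` and `W_p(κ♯μ,ν) ≤ τ`, then for any `μ'`, with `ε = ‖μ − μ'‖_TV`,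
`E_p(κ;μ',ν) ≤ 3 diam(Y) ε^{1/p} + 3τ`. -/
theorem ep_tv_stability_refined {d : ℕ} (hd : 1 ≤ d) {p : ℝ} (hp : 1 ≤ p)
    (X Y : Set (Rd d)) (hX : MeasurableSet X) (hY : MeasurableSet Y)
    (hYbdd : Bornology.IsBounded Y)
    (μ μ' ν : Measure (Rd d)) [IsProbabilityMeasure μ] [IsProbabilityMeasure μ']
    [IsProbabilityMeasure ν]
    (hμX : μ X = 1) (hμ'X : μ' X = 1) (hνY : ν Y = 1)
    (hμmom : HasFiniteMoment p μ) (hμ'mom : HasFiniteMoment p μ') (hνmom : HasFiniteMoment p ν)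
    (κ : Kernel (Rd d) (Rd d)) [IsMarkovKernel κ] (hκY : ∀ x ∈ X, κ x Y = 1)
    (τ : ℝ) (hτ : 0 ≤ τ)
    (hnearopt : (∫ x, ∫ y, ‖y - x‖ ^ p ∂(κ x) ∂μ) ≤ Wp p μ (kpush κ μ) ^ p + τ ^ p)
    (hfeas : Wp p (kpush κ μ) ν ≤ τ) :
    Ep p κ μ' ν ≤ 3 * Metric.diam Y * tvDist μ μ' ^ (1 / p) + 3 * τ := by
  have hp0 : 0 < p := by linarith
  have hμ₁ : IsProbabilityMeasure (kpush κ μ) :=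
    ⟨by rw [← (isCoupling_compProd κ μ).univ_eq_univ, measure_univ]⟩
  have hμ'₁ : IsProbabilityMeasure (kpush κ μ') :=
    ⟨by rw [← (isCoupling_compProd κ μ').univ_eq_univ, measure_univ]⟩
  have hμY := ae_mem_kpush hX hY κ μ hμX hκY
  have hμ'Y := ae_mem_kpush hX hY κ μ' hμ'X hκY
  have hνY' : ∀ᵐ y ∂ν, y ∈ Y := (mem_ae_iff_prob_eq_one hY).2 hνY
  have hpushmom := hasFiniteMoment_of_ae_mem hp hYbdd _ hμY
  have hpush'mom := hasFiniteMoment_of_ae_mem hp hYbdd _ hμ'Y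
  have hfin := (isCoupling_compProd κ μ).displacementNorm_ne_top hp hμmom hpushmom
  have hfin' := (isCoupling_compProd κ μ').displacementNorm_ne_top hp hμ'mom hpush'mom
  have htv : 0 ≤ tvDist μ μ' := (abs_nonneg _).trans (abs_sub_le_tvDist μ μ' .univ)
  have hopt := near_optimal_displacementNorm hp κ μ hfin hτ hnearopt
  set e := ENNReal.ofReal (Metric.diam Y) * ENNReal.ofReal (tvDist μ μ') ^ (1 / p) with he
  have hefin : e ≠ ⊤ := ENNReal.mul_ne_top ENNReal.ofReal_ne_top
    (ENNReal.rpow_ne_top_of_nonneg (by positivity) ENNReal.ofReal_ne_top)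
  have hereal : e.toReal = Metric.diam Y * tvDist μ μ' ^ (1 / p) := by
    rw [he, ENNReal.toReal_mul, ENNReal.toReal_ofReal Metric.diam_nonneg,
      ← ENNReal.toReal_rpow, ENNReal.toReal_ofReal htv]
  obtain ⟨s, a, b, hsa, hsb, S, hS, ha, hb⟩ := exists_common_part μ μ'
  have haε := le_ofReal_tvDist μ μ' hS ha
  have hbε := le_ofReal_tvDist μ' μ hS.compl hb
  rw [tvDist_comm] at hbε
  have hs : IsFiniteMeasure s := isFiniteMeasure_of_le μ (hsa ▸ Measure.le_add_right le_rfl)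
  have hafin : IsFiniteMeasure a := isFiniteMeasure_of_le μ (hsa ▸ Measure.le_add_left le_rfl)
  have hbfin : IsFiniteMeasure b := isFiniteMeasure_of_le μ' (hsb ▸ Measure.le_add_left le_rfl)
  have hbY : ∀ᵐ y ∂(kpush κ b), y ∈ Y := by
    rw [hsb, kpush_add] at hμ'Y
    exact (ae_add_measure_iff.1 hμ'Y).2
  have hclose : ∀ A, MeasurableSet A →
      kpush κ μ' A ≤ kpush κ μ A + ENNReal.ofReal (tvDist μ μ') := by
    intro A _
    have hbA : kpush κ b A ≤ ENNReal.ofReal (tvDist μ μ') := by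
      refine (measure_mono (subset_univ A)).trans ?_
      rwa [← (isCoupling_compProd κ b).univ_eq_univ]
    have h₁ := congrArg (fun m => kpush κ m A) hsa
    have h₂ := congrArg (fun m => kpush κ m A) hsb
    simp only [kpush_add, Measure.add_apply] at h₁ h₂
    rw [h₁, h₂]
    gcongr
    exact le_self_add
  obtain ⟨q, hq, hqle⟩ := exists_isCoupling_of_le_add hp hYbdd (kpush κ μ') (kpush κ μ)
    hμ'Y hμY (by simp) hclose
  refine le_of_forall_pos_le_add fun δ hδ => ?_
  obtain ⟨π, hπ, hπfin, hπle⟩ := exists_isCoupling_lt_Wp_add hp μ' ν hμ'mom hνmom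
    (δ := δ / 3) (by linarith)
  obtain ⟨γ, hγ, hγfin, hγle⟩ := exists_isCoupling_lt_Wp_add hp (kpush κ μ) ν hpushmom hνmom
    (δ := δ / 3) (by linarith)
  have hcost : kernelCost p κ μ' ≤ Wp p μ' ν + δ / 3 + (τ + δ / 3 + τ + 2 * e.toReal) := by
    have h : displacementNorm p (μ' ⊗ₘ κ) ≤ displacementNorm p π +
        (displacementNorm p γ + ENNReal.ofReal τ + 2 * e) := by
      rw [hsb]
      rw [hsa] at hμY hfin hopt hγ
      rw [hsb] at hπ
      exact displacementNorm_compProd_le hp hYbdd κ s a b ν haε hbε hνY' hμY hbY hfin hopt hπ hγ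
    have h2e : 2 * e ≠ ⊤ := ENNReal.mul_ne_top (by simp) hefin
    have hγτ : displacementNorm p γ + ENNReal.ofReal τ ≠ ⊤ :=
      ENNReal.add_ne_top.2 ⟨hγfin, ENNReal.ofReal_ne_top⟩
    have hrest := ENNReal.add_ne_top.2 ⟨hγτ, h2e⟩
    have hreal := ENNReal.toReal_mono (ENNReal.add_ne_top.2 ⟨hπfin, hrest⟩) h
    rw [toReal_displacementNorm_compProd hp κ μ' hfin', ENNReal.toReal_add hπfin hrest,
      ENNReal.toReal_add hγτ h2e, ENNReal.toReal_add hγfin ENNReal.ofReal_ne_top,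
      ENNReal.toReal_ofReal hτ, ENNReal.toReal_mul, ENNReal.toReal_ofNat] at hreal
    linarith
  have hW : Wp p (kpush κ μ') ν ≤ e.toReal + (τ + δ / 3) := by
    obtain ⟨r, hr, hrle⟩ := hq.exists_trans hp hγ
    have hrle' := hrle.trans (add_le_add_left hqle _)
    have hfin₂ := ENNReal.add_ne_top.2 ⟨hefin, hγfin⟩
    have hreal := ENNReal.toReal_mono hfin₂ hrle'
    rw [ENNReal.toReal_add hefin hγfin] at hreal
    linarith [hr.Wp_le hp (ne_top_of_le_ne_top hfin₂ hrle')]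
  have he0 : 0 ≤ e.toReal := ENNReal.toReal_nonneg
  have hmax : max (kernelCost p κ μ' - Wp p μ' ν) 0 ≤ 2 * e.toReal + 2 * τ + 2 * (δ / 3) :=
    max_le (by linarith) (by positivity)
  rw [Ep, mul_assoc, ← hereal]
  linarith
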